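/- Let n, d, r be positive integers and let π ∈ OP(n,d,r). Let c_n ∈ S_n be the long cycle with c_n(1) = n and c_n(i) = i−1 for 2 ≤ i ≤ n, and let w_0 ∈ S_n be the longest element, w_0(i) = n+1−i. With the action of S_n on ℂ[x_{ij}] given by w·x_{i,j} = x_{i,w(j)}, one has c_n·[π]_r = (−1)^{n−1}·[c_n·π]_r and w_0·[π]_r = (−1)^{n(n−1)/2}·[w_0·π]_r, where w·π denotes the ordered set partition with blocks w·π_i = {w(b) : b ∈ π_i}. -/

import Mathlib

open scoped Classical

namespace Jellyfish

/-- A tableau with `ν` rows and `d` columns, whose cells are either empty or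
contain an element of `Fin n`. -/
abbrev Tab (ν n d : ℕ) := Fin ν → Fin d → Option (Fin n)

/-- `π` is an ordered set partition of `[n]` into `d` blocks, each of size at least `r`:
blocks are pairwise disjoint with union `[n]` and cardinality at least `r`. -/
def IsOSP (n d r : ℕ) (π : Fin d → Finset (Fin n)) : Prop :=
  (∀ j, r ≤ (π j).card) ∧
  (∀ j k, j ≠ k → Disjoint (π j) (π k)) ∧
  (Finset.univ.biUnion π = Finset.univ)

/-- The nonempty entries of column `j` of `T`, read from top to bottom. -/
def colList {ν n d : ℕ} (T : Tab ν n d) (j : Fin d) : List (Fin n) :=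
  (List.finRange ν).filterMap (fun i => T i j)

/-- `T` is an `r`-jellyfish tableau for `π`: it has `n - (d-1)r` rows and `d` columns,
every cell in the first `r` rows is nonempty, every lower row has exactly one nonempty
cell, and the nonempty entries of column `j`, top to bottom, are exactly the elements
of `π j` in increasing order. -/
def IsJelly (n d r : ℕ) (π : Fin d → Finset (Fin n)) (T : Tab (n - (d-1)*r) n d) : Prop :=
  (∀ i : Fin (n - (d-1)*r), (i : ℕ) < r → ∀ j, (T i j).isSome) ∧
  (∀ i : Fin (n - (d-1)*r), r ≤ (i : ℕ) → ∃! j, (T i j).isSome) ∧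
  (∀ j, colList T j = (π j).sort (· ≤ ·))

/-- The row reading word of `T` (rows top to bottom, each row left to right), with
each entry tagged by its column index. -/
def cells {ν n d : ℕ} (T : Tab ν n d) : List (Fin d × Fin n) :=
  (List.finRange ν).flatMap (fun i =>
    (List.finRange d).filterMap (fun j => (T i j).map (fun v => (j, v))))

/-- The number of inversions of a (column-tagged) word: pairs of positions `p < q`
whose values are inverted. -/
def invList {n d : ℕ} : List (Fin d × Fin n) → ℕ
  | [] => 0
  | a :: l => l.countP (fun b => decide (b.2 < a.2)) + invList l

/-- The number of inversions of a (column-tagged) word that do not involve two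
entries lying in the same column. -/
def invList' {n d : ℕ} : List (Fin d × Fin n) → ℕ
  | [] => 0
  | a :: l => l.countP (fun b => decide (b.2 < a.2 ∧ b.1 ≠ a.1)) + invList' l

/-- The sign `(-1)^(inv T)` of a tableau, where `inv T` counts all inversions of the
row reading word. -/
def tabSign {ν n d : ℕ} (T : Tab ν n d) : ℤ := (-1) ^ invList (cells T)

/-- The sign `(-1)^(inv T)` of a (column-permuted) tableau, where inversions within a
single column are not counted. -/
def tabSign' {ν n d : ℕ} (T : Tab ν n d) : ℤ := (-1) ^ invList' (cells T)

/-- The minor `M_I^J` of the `ν × n` matrix of indeterminates `x_{ij}`: the determinant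
of the submatrix with rows `I` and columns `J`, each taken in increasing order
(and `0` if `|I| ≠ |J|`). -/
noncomputable def minor (ν n : ℕ) (I : Finset (Fin ν)) (J : Finset (Fin n)) :
    MvPolynomial (Fin ν × Fin n) ℂ :=
  if h : I.card = J.card then
    Matrix.det (Matrix.of fun a b : Fin I.card =>
      MvPolynomial.X (I.orderEmbOfFin rfl a, J.orderEmbOfFin h.symm b))
  else 0

/-- The set `R_j(T)` of rows of `T` containing an entry of block `j`. -/
def rowsUsed {ν n d : ℕ} (T : Tab ν n d) (j : Fin d) : Finset (Fin ν) :=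
  Finset.univ.filter (fun i => (T i j).isSome)

/-- The product of minors `J(T) = ∏_j M_{R_j(T)}^{π_j}`. -/
noncomputable def JProd {ν n d : ℕ} (π : Fin d → Finset (Fin n)) (T : Tab ν n d) :
    MvPolynomial (Fin ν × Fin n) ℂ :=
  ∏ j : Fin d, minor ν n (rowsUsed T j) (π j)

/-- The `r`-jellyfish invariant `[π]_r = Σ_{T ∈ J_r(π)} sgn(T)·J(T)`. -/
noncomputable def jellyInv (n d r : ℕ) (π : Fin d → Finset (Fin n)) :
    MvPolynomial (Fin (n - (d-1)*r) × Fin n) ℂ :=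
  ∑ T : Tab (n - (d-1)*r) n d,
    if IsJelly n d r π T then (tabSign T : ℂ) • JProd π T else 0


/-- Permute the columns of `T` according to `σ`: column `j` of the result is
column `σ⁻¹ j` of `T`. -/
def colPerm {ν n d : ℕ} (σ : Equiv.Perm (Fin d)) (T : Tab ν n d) : Tab ν n d :=
  fun i j => T i (σ⁻¹ j)

/-- The top `k` rows of a tableau with `ν` rows. -/
def topRows (ν k : ℕ) : Finset (Fin ν) := Finset.univ.filter (fun i => (i : ℕ) < k)

/-- The top-justified minor `p_J`, using rows `1, …, |J|` and the columns in `J`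
(in increasing order). -/
noncomputable def topMinor (ν n : ℕ) (J : Finset (Fin n)) :
    MvPolynomial (Fin ν × Fin n) ℂ :=
  minor ν n (topRows ν J.card) J

/-- The spanning set of the flamingo Specht module `S^{(d^r, 1^{n-rd})}`: all products
`∏_i p_{J_i}` over tuples `(J_1, …, J_d)` of pairwise disjoint subsets of `[n]` with
union `[n]`, `|J_1| = n-(d-1)r` and `|J_i| = r` for `i ≥ 2`. -/
def flamingoSet (n d r : ℕ) : Set (MvPolynomial (Fin (n - (d-1)*r) × Fin n) ℂ) :=
  { f | ∃ Js : Fin d → Finset (Fin n),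
      (∀ i j, i ≠ j → Disjoint (Js i) (Js j)) ∧
      (Finset.univ.biUnion Js = Finset.univ) ∧
      (∀ i : Fin d, (i : ℕ) = 0 → (Js i).card = n - (d-1)*r) ∧
      (∀ i : Fin d, (i : ℕ) ≠ 0 → (Js i).card = r) ∧
      f = ∏ i : Fin d, topMinor (n - (d-1)*r) n (Js i) }

/-- `P` is an (unordered) set partition of `[n]`: a collection of pairwise disjoint
nonempty blocks whose union is `[n]`. -/
def IsUPartition (n : ℕ) (P : Finset (Finset (Fin n))) : Prop :=
  (∀ B ∈ P, B.Nonempty) ∧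
  (∀ B1 ∈ P, ∀ B2 ∈ P, B1 ≠ B2 → Disjoint B1 B2) ∧
  (∀ x : Fin n, ∃ B ∈ P, x ∈ B)

/-- `P` is noncrossing: there do not exist `a < b < c < e` with `a, c` in one block
and `b, e` in a different block. -/
def IsNoncrossing (n : ℕ) (P : Finset (Finset (Fin n))) : Prop :=
  ∀ a b c e : Fin n, a < b → b < c → c < e →
    ∀ B1 ∈ P, ∀ B2 ∈ P, a ∈ B1 → c ∈ B1 → b ∈ B2 → e ∈ B2 → B1 = B2

/-- `P` is a noncrossing set partition of `[n]` into `d` blocks, each of size at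
least `r` (the set `NC(n,d,r)`). -/
def IsNCPartition (n d r : ℕ) (P : Finset (Finset (Fin n))) : Prop :=
  IsUPartition n P ∧ IsNoncrossing n P ∧ P.card = d ∧ ∀ B ∈ P, r ≤ B.card

/-- The set of smallest elements of the blocks of an ordered set partition. -/
def blockMinima (n d : ℕ) (π : Fin d → Finset (Fin n)) : Finset (Fin n) :=
  Finset.univ.filter (fun x => ∃ j, x ∈ π j ∧ ∀ y ∈ π j, x ≤ y)

/-- The set of smallest elements (block minima) of an unordered set partition. -/
def blockMinimaU (n : ℕ) (P : Finset (Finset (Fin n))) : Finset (Fin n) :=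
  Finset.univ.filter (fun x => ∃ B ∈ P, x ∈ B ∧ ∀ y ∈ B, x ≤ y)

/-- The set of largest elements (block maxima) of an unordered set partition. -/
def blockMaximaU (n : ℕ) (P : Finset (Finset (Fin n))) : Finset (Fin n) :=
  Finset.univ.filter (fun x => ∃ B ∈ P, x ∈ B ∧ ∀ y ∈ B, y ≤ x)

lemma neg_one_pow_countP_ofFn {α : Type*} {m : ℕ} (f : Fin m → α) (p : α → Bool) :
    (-1 : ℤ) ^ (List.ofFn f).countP p = ∏ i, if p (f i) then -1 else 1 := by
  induction m with
  | zero => simp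
  | succ m ih =>
    rw [List.ofFn_succ, List.countP_cons, Fin.prod_univ_succ, pow_add, ih, mul_comm]
    congr 1
    split_ifs <;> simp

lemma neg_one_pow_invList_ofFn {n d m : ℕ} (f : Fin m → Fin d × Fin n) :
    (-1 : ℤ) ^ invList (List.ofFn f) =
      ∏ i, ∏ j ∈ Finset.Ioi i, if (f j).2 < (f i).2 then -1 else 1 := by
  induction m with
  | zero => simp [invList]
  | succ m ih =>
    rw [List.ofFn_succ, invList, Fin.prod_univ_succ, pow_add, ih, neg_one_pow_countP_ofFn]
    congr 1
    · rw [Fin.prod_Ioi_zero]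
      exact Finset.prod_congr rfl fun _ _ => if_congr decide_eq_true_iff rfl rfl
    · simp [Fin.prod_Ioi_succ]

/-- If the values of a tagged word form a permutation `σ`, its inversion sign is `sign σ`. -/
lemma neg_one_pow_invList_eq_sign {n d : ℕ} (f : Fin n → Fin d × Fin n)
    (σ : Equiv.Perm (Fin n)) (hσ : ∀ i, (f i).2 = σ i) :
    (-1 : ℤ) ^ invList (List.ofFn f) = (Equiv.Perm.sign σ : ℤ) := by
  rw [neg_one_pow_invList_ofFn, σ.sign_eq_prod_prod_Ioi]
  push_cast
  refine Finset.prod_congr rfl fun i _ => Finset.prod_congr rfl fun j hj => ?_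
  have hne : σ i ≠ σ j := fun h => (Finset.mem_Ioi.1 hj).ne (σ.injective h)
  rw [hσ, hσ]
  rcases lt_or_gt_of_ne hne with h | h
  · rw [if_neg h.not_gt, if_pos h]; rfl
  · rw [if_pos h, if_neg h.not_gt]; rfl

/-- Applying `u` to every letter of a word containing each letter once multiplies its inversion
sign by `sign u`. -/
lemma neg_one_pow_invList_map {n d : ℕ} (l : List (Fin d × Fin n)) (hl : l.length = n)
    (hmem : ∀ v, ∃ a ∈ l, a.2 = v) (u : Equiv.Perm (Fin n)) :
    (-1 : ℤ) ^ invList (l.map fun a => (a.1, u a.2)) =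
      (Equiv.Perm.sign u : ℤ) * (-1) ^ invList l := by
  obtain ⟨f, rfl⟩ : ∃ f : Fin n → Fin d × Fin n, l = List.ofFn f :=
    ⟨fun i => l.get (i.cast hl.symm), by
      refine List.ext_get (by simp [hl]) fun i h₁ h₂ => ?_
      simp⟩
  have hsurj : Function.Surjective fun i => (f i).2 := fun v => by
    obtain ⟨a, ha, rfl⟩ := hmem v
    obtain ⟨i, rfl⟩ := (List.mem_ofFn' f a).1 ha
    exact ⟨i, rfl⟩
  let σ := Equiv.ofBijective _ ⟨Finite.injective_iff_surjective.2 hsurj, hsurj⟩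
  rw [List.map_ofFn, neg_one_pow_invList_eq_sign f σ fun _ => rfl,
    neg_one_pow_invList_eq_sign _ (u * σ) fun _ => rfl]
  simp

/-- The tableau obtained by applying `u` to every entry of `T`. -/
def mapTab {ν n d : ℕ} (u : Equiv.Perm (Fin n)) : Tab ν n d ≃ Tab ν n d :=
  Equiv.piCongrRight fun _ => Equiv.piCongrRight fun _ => Equiv.optionCongr u

lemma mapTab_apply {ν n d : ℕ} (u : Equiv.Perm (Fin n)) (T : Tab ν n d) (i : Fin ν) (j : Fin d) :
    mapTab u T i j = (T i j).map u := rfl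

lemma cells_mapTab {ν n d : ℕ} (u : Equiv.Perm (Fin n)) (T : Tab ν n d) :
    cells (mapTab u T) = (cells T).map fun a => (a.1, u a.2) := by
  simp only [cells, List.map_flatMap, List.map_filterMap, mapTab_apply, Option.map_map]
  rfl

lemma colList_mapTab {ν n d : ℕ} (u : Equiv.Perm (Fin n)) (T : Tab ν n d) (j : Fin d) :
    colList (mapTab u T) j = (colList T j).map u := by
  simp only [colList, List.map_filterMap, mapTab_apply]

lemma rowsUsed_mapTab {ν n d : ℕ} (u : Equiv.Perm (Fin n)) (T : Tab ν n d) (j : Fin d) :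
    rowsUsed (mapTab u T) j = rowsUsed T j := by
  simp [rowsUsed, mapTab_apply]

lemma length_filterMap_finRange {α : Type*} {m : ℕ} (f : Fin m → Option α) :
    ((List.finRange m).filterMap f).length = ∑ i, if (f i).isSome then 1 else 0 := by
  rw [List.length_filterMap_eq_countP, List.countP_eq_length_filter, ← Finset.card_filter]
  rw [← List.toFinset_card_of_nodup ((List.nodup_finRange m).filter _)]
  congr 1
  ext; simp

lemma length_cells {ν n d : ℕ} (T : Tab ν n d) :
    (cells T).length = ∑ j, (colList T j).length := by
  simp only [cells, colList, List.length_flatMap, length_filterMap_finRange, Option.isSome_map]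
  rw [Finset.sum_comm, ← List.ofFn_eq_map, List.sum_ofFn]

/-- Applying `u` to the entries of a jellyfish tableau multiplies its sign by `sign u`. -/
lemma tabSign_mapTab {n d r : ℕ} {π : Fin d → Finset (Fin n)} (hπ : IsOSP n d r π)
    {T : Tab (n - (d - 1) * r) n d} (hT : IsJelly n d r π T) (u : Equiv.Perm (Fin n)) :
    tabSign (mapTab u T) = (Equiv.Perm.sign u : ℤ) * tabSign T := by
  rw [tabSign, cells_mapTab, tabSign]
  refine neg_one_pow_invList_map _ ?_ (fun v => ?_) u
  · simp only [length_cells, hT.2.2, Finset.length_sort]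
    rw [← Finset.card_biUnion fun i _ j _ hij => hπ.2.1 i j hij, hπ.2.2]
    simp
  · obtain ⟨j, -, hj⟩ := Finset.mem_biUnion.1 (hπ.2.2 ▸ Finset.mem_univ v)
    rw [← Finset.mem_sort (· ≤ ·), ← hT.2.2 j, colList, List.mem_filterMap] at hj
    obtain ⟨i, -, hi⟩ := hj
    refine ⟨(j, v), ?_, rfl⟩
    simp only [cells, List.mem_flatMap, List.mem_filterMap]
    exact ⟨i, List.mem_finRange i, j, List.mem_finRange j, by simp [hi]⟩

lemma isJelly_mapTab_iff {n d r : ℕ} {π π' : Fin d → Finset (Fin n)} {u : Equiv.Perm (Fin n)}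
    (hu : ∀ j, StrictMonoOn u (π j)) (hπ' : ∀ j, (π j).image u = π' j)
    (T : Tab (n - (d - 1) * r) n d) : IsJelly n d r π' (mapTab u T) ↔ IsJelly n d r π T := by
  have hsort : ∀ j, (π' j).sort (· ≤ ·) = ((π j).sort (· ≤ ·)).map u := fun j => by
    rw [← hπ' j]
    refine (((hu j).map_finsetSort u.toEmbedding).trans ?_).symm
    rw [Finset.map_eq_image]; rfl
  simp only [IsJelly, mapTab_apply, Option.isSome_map, colList_mapTab, hsort,
    (List.map_injective_iff.2 u.injective).eq_iff]

lemma minor_image {ν n : ℕ} (I : Finset (Fin ν)) (S : Finset (Fin n)) (w u : Equiv.Perm (Fin n))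
    (hu : StrictMonoOn u S) (himg : S.image u = S.image w)
    (hρ : ∀ x, (w⁻¹ * u) x ∈ S ↔ x ∈ S) :
    minor ν n I (S.image w) =
      ((Equiv.Perm.sign ((w⁻¹ * u).subtypePerm hρ) : ℤ) : MvPolynomial (Fin ν × Fin n) ℂ) *
        MvPolynomial.rename (fun p => (p.1, w p.2)) (minor ν n I S) := by
  have hcard : (S.image w).card = S.card := Finset.card_image_of_injective _ w.injective
  unfold minor
  by_cases h : I.card = S.card
  · rw [dif_pos h, dif_pos (h.trans hcard.symm), AlgHom.map_det]
    let e : Fin I.card ≃ S := (S.orderIsoOfFin h.symm).toEquiv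
    let τ : Equiv.Perm (Fin I.card) := e.symm.permCongr ((w⁻¹ * u).subtypePerm hρ)
    have hτ : Equiv.Perm.sign τ = Equiv.Perm.sign ((w⁻¹ * u).subtypePerm hρ) :=
      Equiv.Perm.sign_permCongr _ _
    rw [← hτ, ← Matrix.det_permute']
    congr 1
    ext1 a b
    have hemb : (S.image w).orderEmbOfFin (h.trans hcard.symm).symm b
        = u (S.orderEmbOfFin h.symm b) := by
      refine congrFun (Finset.orderEmbOfFin_unique _ (f := fun b => u (S.orderEmbOfFin h.symm b))
        (fun x => ?_) fun x y hxy => ?_).symm b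
      · rw [← himg]
        exact Finset.mem_image_of_mem _ (Finset.orderEmbOfFin_mem _ _ _)
      · exact hu (Finset.orderEmbOfFin_mem _ _ _) (Finset.orderEmbOfFin_mem _ _ _)
          ((S.orderEmbOfFin h.symm).strictMono hxy)
    have hcomp : w (S.orderEmbOfFin h.symm (τ b)) = u (S.orderEmbOfFin h.symm b) := by
      have : S.orderEmbOfFin h.symm (τ b) = (e (τ b) : Fin n) := rfl
      rw [this]
      simp only [τ, Equiv.permCongr_apply, Equiv.symm_symm, Equiv.apply_symm_apply,
        Equiv.Perm.subtypePerm_apply, Equiv.Perm.mul_apply]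
      exact w.apply_symm_apply _
    simp only [Matrix.of_apply, Matrix.submatrix_apply, AlgHom.mapMatrix_apply, Matrix.map_apply,
      MvPolynomial.rename_X, id, hcomp, hemb]
  · rw [dif_neg h, dif_neg (hcard ▸ h)]
    simp

/-- The sign of a permutation preserving the fibres of `b` is the product of the signs of its
restrictions to the fibres. -/
lemma sign_eq_prod_sign_subtypePerm {ι κ : Type*} [Fintype ι] [DecidableEq ι] [Fintype κ]
    [LinearOrder κ] (ρ : Equiv.Perm ι) (b : ι → κ) (hb : ∀ x, b (ρ x) = b x) :
    (Equiv.Perm.sign ρ : ℤ) =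
      ∏ k, (Equiv.Perm.sign (ρ.subtypePerm (p := fun x => b x = k) fun x => by rw [hb]) : ℤ) := by
  have hM : (ρ.permMatrix ℤ).BlockTriangular b := fun i j hij => by
    simp only [Equiv.Perm.permMatrix, PEquiv.toMatrix_apply, Equiv.toPEquiv_apply]
    refine if_neg fun h => hij.ne ?_
    simp only [Option.mem_def, Option.some.injEq] at h
    rw [← h, hb]
  have hdet := hM.det_fintype
  rw [Matrix.det_permutation] at hdet
  refine hdet.trans (Finset.prod_congr rfl fun k _ => ?_)
  rw [← Int.cast_id (n := ((Equiv.Perm.sign _ : ℤˣ) : ℤ)), ← Matrix.det_permutation]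
  congr 1
  ext i j
  simp [Matrix.toSquareBlock_def, Equiv.Perm.permMatrix, PEquiv.toMatrix_apply, Subtype.ext_iff]

/-- For finite sets of equal size there is a function mapping one increasingly onto the other. -/
lemma exists_strictMonoOn_image_eq {n : ℕ} (S S' : Finset (Fin n)) (h : S'.card = S.card) :
    ∃ g : Fin n → Fin n, StrictMonoOn g S ∧ S.image g = S' := by
  let e : S ≃o S' := (S.orderIsoOfFin rfl).symm.trans (S'.orderIsoOfFin h)
  refine ⟨fun x => if hx : x ∈ S then e ⟨x, hx⟩ else x, fun x hx y hy hxy => ?_, ?_⟩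
  · have hx' : x ∈ S := hx
    have hy' : y ∈ S := hy
    simp only [hx', hy', dif_pos]
    exact e.strictMono hxy
  · ext y
    simp only [Finset.mem_image]
    constructor
    · rintro ⟨x, hx, rfl⟩
      simp [hx]
    · intro hy
      exact ⟨e.symm ⟨y, hy⟩, (e.symm ⟨y, hy⟩).2, by simp⟩

/-- Any permutation `w` agrees, up to permutations within the blocks of `π`, with a permutation
that is increasing on each block. -/
lemma exists_perm_strictMonoOn {n d : ℕ} (π : Fin d → Finset (Fin n)) (b : Fin n → Fin d)
    (hb : ∀ x j, x ∈ π j ↔ b x = j) (w : Equiv.Perm (Fin n)) :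
    ∃ u : Equiv.Perm (Fin n),
      ∀ j, StrictMonoOn u (π j) ∧ (π j).image u = (π j).image w := by
  choose g hg hgi using fun j => exists_strictMonoOn_image_eq (π j) ((π j).image w)
    (Finset.card_image_of_injective _ w.injective)
  have hgb : ∀ j, Set.EqOn (fun x => g (b x) x) (g j) (π j) := fun j x hx => by
    simp only [(hb x j).1 hx]
  have hsurj : Function.Surjective fun x => g (b x) x := fun y => by
    have hy : y ∈ (π (b (w⁻¹ y))).image w :=
      Finset.mem_image.2 ⟨w⁻¹ y, (hb _ _).2 rfl, by simp⟩
    rw [← hgi] at hy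
    obtain ⟨x, hx, hxy⟩ := Finset.mem_image.1 hy
    exact ⟨x, (hgb _ hx).trans hxy⟩
  refine ⟨Equiv.ofBijective _ ⟨Finite.injective_iff_surjective.2 hsurj, hsurj⟩, fun j => ⟨?_, ?_⟩⟩
  · exact (hg j).congr (hgb j).symm
  · rw [← hgi j]
    exact Finset.image_congr (hgb j)

/-- Every permutation acts on jellyfish invariants by its sign. -/
lemma rename_jellyInv {n d r : ℕ} {π : Fin d → Finset (Fin n)} (hπ : IsOSP n d r π)
    (w : Equiv.Perm (Fin n)) :
    MvPolynomial.rename (fun p : Fin (n - (d - 1) * r) × Fin n => (p.1, w p.2))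
        (jellyInv n d r π) =
      ((Equiv.Perm.sign w : ℤ) : ℂ) • jellyInv n d r (fun j => (π j).image w) := by
  have hex : ∀ x, ∃ j, x ∈ π j := fun x => by
    simpa using (hπ.2.2 ▸ Finset.mem_univ x : x ∈ Finset.univ.biUnion π)
  choose b hbm using hex
  have hb : ∀ x j, x ∈ π j ↔ b x = j := fun x j =>
    ⟨fun hx => by_contra fun hne => Finset.disjoint_left.1 (hπ.2.1 _ _ hne) (hbm x) hx,
      fun h => h ▸ hbm x⟩
  obtain ⟨u, hu⟩ := exists_perm_strictMonoOn π b hb w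
  have hρ : ∀ j x, (w⁻¹ * u) x ∈ π j ↔ x ∈ π j := fun j x => by
    rw [← w.injective.mem_finset_image, ← (hu j).2, Equiv.Perm.mul_apply,
      ← u.injective.mem_finset_image (s := π j) (a := x)]
    simp
  have hbρ : ∀ x, b ((w⁻¹ * u) x) = b x := fun x => (hb _ _).1 ((hρ _ x).2 (hbm x))
  have hJ : ∀ T : Tab (n - (d - 1) * r) n d,
      JProd (fun j => (π j).image w) (mapTab u T) =
        ((Equiv.Perm.sign (w⁻¹ * u) : ℤ) : MvPolynomial (Fin (n - (d - 1) * r) × Fin n) ℂ) *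
          MvPolynomial.rename (fun p => (p.1, w p.2)) (JProd π T) := fun T => by
    rw [sign_eq_prod_sign_subtypePerm (w⁻¹ * u) b hbρ]
    simp only [JProd, rowsUsed_mapTab, map_prod, Int.cast_prod, ← Finset.prod_mul_distrib]
    refine Finset.prod_congr rfl fun j _ => ?_
    rw [minor_image _ _ w u (hu j).1 (hu j).2 (hρ j),
      Equiv.Perm.sign_eq_sign_of_equiv ((w⁻¹ * u).subtypePerm (hρ j))
        ((w⁻¹ * u).subtypePerm (p := fun x => b x = j) fun x => by rw [hbρ])
        (Equiv.subtypeEquivRight fun x => hb x j) fun _ => rfl]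
  rw [jellyInv, jellyInv, map_sum, Finset.smul_sum, ← (mapTab u).sum_comp fun T => _ • _]
  refine Finset.sum_congr rfl fun T _ => ?_
  have hiff := isJelly_mapTab_iff (fun j => (hu j).1) (fun j => (hu j).2) T
  by_cases hT : IsJelly n d r π T
  · rw [if_pos hT, if_pos (hiff.2 hT), hJ, tabSign_mapTab hπ hT, map_smul]
    have hsign : ((Equiv.Perm.sign w : ℤ) : ℂ) * (Equiv.Perm.sign u : ℤ) *
        (Equiv.Perm.sign (w⁻¹ * u) : ℤ) = 1 := by
      rw [Equiv.Perm.sign_mul, Equiv.Perm.sign_inv]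
      rcases Int.units_eq_one_or (Equiv.Perm.sign w) with hw | hw <;>
        rcases Int.units_eq_one_or (Equiv.Perm.sign u) with hu | hu <;> simp [hw, hu]
    have hcast : ((Equiv.Perm.sign (w⁻¹ * u) : ℤ) :
        MvPolynomial (Fin (n - (d - 1) * r) × Fin n) ℂ) =
          MvPolynomial.C ((Equiv.Perm.sign (w⁻¹ * u) : ℤ) : ℂ) := by simp
    rw [hcast, ← MvPolynomial.smul_eq_C_mul, smul_smul, smul_smul]
    congr 1
    push_cast at hsign ⊢
    linear_combination -(tabSign T : ℂ) * hsign
  · simp [hT, mt hiff.1 hT]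

lemma sign_eq_of_longCycle {n : ℕ} (c : Equiv.Perm (Fin n))
    (hc : ∀ i : Fin n, (c i : ℕ) = if (i : ℕ) = 0 then n - 1 else (i : ℕ) - 1) :
    Equiv.Perm.sign c = (-1) ^ (n - 1) := by
  have h : finRotate n * c = 1 := by
    ext i
    obtain ⟨m, rfl⟩ := Nat.exists_eq_succ_of_ne_zero i.pos.ne'
    have := i.isLt
    simp only [Equiv.Perm.mul_apply, coe_finRotate, Fin.ext_iff, hc, Fin.val_last,
      Equiv.Perm.one_apply]
    split_ifs <;> omega
  rw [eq_inv_of_mul_eq_one_right h, Equiv.Perm.sign_inv, sign_finRotate]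

lemma sign_eq_of_longest {n : ℕ} (w₀ : Equiv.Perm (Fin n))
    (hw₀ : ∀ i : Fin n, (w₀ i : ℕ) = n - 1 - (i : ℕ)) :
    Equiv.Perm.sign w₀ = (-1) ^ (n * (n - 1) / 2) := by
  have h : ∀ j, ∏ i ∈ Finset.Iio j, (if w₀ i < w₀ j then 1 else -1 : ℤˣ) = (-1) ^ (j : ℕ) :=
    fun j => by
      rw [Finset.prod_congr rfl fun i hi => if_neg ?_, Finset.prod_const, Fin.card_Iio]
      have := Finset.mem_Iio.1 hi
      rw [Fin.lt_def] at this ⊢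
      rw [hw₀, hw₀]
      omega
  rw [Equiv.Perm.sign_eq_prod_prod_Iio, Finset.prod_congr rfl fun j _ => h j,
    Finset.prod_pow_eq_pow_sum, Fin.sum_univ_eq_sum_range (fun i => i), Finset.sum_range_id]

/-- the long cycle `c_n` acts on jellyfish invariants by rotation up to
the sign `(−1)^{n−1}`, and the longest element `w_0` acts by reflection up to the
sign `(−1)^{n(n−1)/2}`. (Here `Fin n` is `0`-indexed, so `c (0) = n−1` and
`c (i) = i−1` for `i ≥ 1`, and `w0 (i) = n−1−i`.) -/
theorem statement8 (n d r : ℕ) (hn : 0 < n) (hd : 0 < d) (hr : 0 < r)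
    (π : Fin d → Finset (Fin n)) (hπ : IsOSP n d r π)
    (c w0 : Equiv.Perm (Fin n))
    (hc : ∀ i : Fin n, (c i : ℕ) = if (i : ℕ) = 0 then n - 1 else (i : ℕ) - 1)
    (hw0 : ∀ i : Fin n, (w0 i : ℕ) = n - 1 - (i : ℕ)) :
    MvPolynomial.rename (fun p : Fin (n - (d-1)*r) × Fin n => (p.1, c p.2))
        (jellyInv n d r π) =
      ((-1 : ℂ)) ^ (n - 1) • jellyInv n d r (fun j => (π j).image c) ∧
    MvPolynomial.rename (fun p : Fin (n - (d-1)*r) × Fin n => (p.1, w0 p.2))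
        (jellyInv n d r π) =
      ((-1 : ℂ)) ^ (n * (n - 1) / 2) • jellyInv n d r (fun j => (π j).image w0) := by
  refine ⟨?_, ?_⟩
  · rw [rename_jellyInv hπ c, sign_eq_of_longCycle c hc]
    simp
  · rw [rename_jellyInv hπ w0, sign_eq_of_longest w0 hw0]
    simp

end Jellyfish
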